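/- Let φ(x) = e^{-2|x|}, with Fourier transform φ̂(ξ) = 4/(√(2π)(ξ²+4)), and let (α_j)_{j≥1} be positive reals with ∑_{j=1}^∞ α_j e^{4j} < ∞. For s ∈ ℝ define (W(s)φ)(x) := (2π)^{-1/2} ∫_ℝ e^{ixξ} e^{-isξ⁵} φ̂(ξ) dξ. Then for every t ∈ (0,∞) that is not a positive integer, the series v_t(x) := ∑_{j=1}^∞ α_j (W(t-j)φ)(x) converges for every x ∈ ℝ and the resulting function v_t is continuously differentiable (C¹) on ℝ. -/

import Mathlib

open MeasureTheory
open scoped Real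

/-- The Fourier transform of `φ(x) = e^{-2|x|}`: `φ̂(ξ) = 4/(√(2π)(ξ²+4))`. -/
noncomputable def phiHat (ξ : ℝ) : ℂ :=
  ((4 / (Real.sqrt (2 * π) * (ξ ^ 2 + 4)) : ℝ) : ℂ)

/-- `(W(s)φ)(x) = (2π)^{-1/2} ∫ e^{ixξ} e^{-isξ⁵} φ̂(ξ) dξ`. -/
noncomputable def Wphi (s : ℝ) (x : ℝ) : ℂ :=
  (Real.sqrt (2 * π) : ℂ)⁻¹ *
    ∫ ξ : ℝ, Complex.exp (Complex.I * (x * ξ - s * ξ ^ 5)) * phiHat ξ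

open scoped FourierTransform

/-- the oscillatory factor -/
noncomputable def osc (s x ξ : ℝ) : ℂ := Complex.exp (Complex.I * (x * ξ - s * ξ ^ 5))

/-- the base symbol -/
noncomputable def symG (ξ : ℝ) : ℝ := (ξ ^ 2 + 4)⁻¹

/-- the improved symbol -/
noncomputable def symK (ξ : ℝ) : ℝ := (ξ ^ 2 + 4)⁻¹ * (1 + ξ ^ 4)⁻¹

/-- minus the logarithmic derivative of the improved symbol -/
noncomputable def symL (ξ : ℝ) : ℝ := 2 * ξ * (ξ ^ 2 + 4)⁻¹ + 4 * ξ ^ 3 * (1 + ξ ^ 4)⁻¹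

lemma osc_norm (s x ξ : ℝ) : ‖osc s x ξ‖ = 1 := by
  unfold osc
  have : Complex.I * ((x : ℂ) * ξ - s * ξ ^ 5) = ((x * ξ - s * ξ ^ 5 : ℝ) : ℂ) * Complex.I := by
    push_cast; ring
  rw [this, Complex.norm_exp_ofReal_mul_I]

lemma osc_cont (s x : ℝ) : Continuous (osc s x) := by
  unfold osc; fun_prop

lemma osc_split (s x ξ : ℝ) : osc s x ξ = osc 0 x ξ * osc s 0 ξ := by
  unfold osc
  rw [← Complex.exp_add]; congr 1; push_cast; ring

lemma osc_integrable {G : ℝ → ℂ} (hG : Integrable G) (s x : ℝ) :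
    Integrable fun ξ => osc s x ξ * G ξ := by
  refine hG.bdd_mul (c := 1) (osc_cont s x).aestronglyMeasurable ?_
  exact Filter.Eventually.of_forall fun ξ => (osc_norm s x ξ).le

lemma osc_integral_norm_le (G : ℝ → ℂ) (s x : ℝ) :
    ‖∫ ξ, osc s x ξ * G ξ‖ ≤ ∫ ξ, ‖G ξ‖ := by
  refine (norm_integral_le_integral_norm _).trans_eq ?_
  simp [osc_norm]

lemma osc_summable {G : ℝ → ℂ} {β : ℕ → ℂ} (hβ : Summable fun j => ‖β j‖)
    (s : ℕ → ℝ) (x : ℝ) : Summable fun j => β j * ∫ ξ, osc (s j) x ξ * G ξ := by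
  refine Summable.of_norm_bounded (hβ.mul_right (∫ ξ, ‖G ξ‖)) fun j => ?_
  rw [norm_mul]
  exact mul_le_mul_of_nonneg_left (osc_integral_norm_le G _ _) (norm_nonneg _)

lemma osc_contDiff {G : ℝ → ℂ} (hG : Integrable G) (hG1 : Integrable fun ξ : ℝ => (ξ : ℂ) * G ξ)
    {β : ℕ → ℂ} (hβ : Summable fun j => ‖β j‖) (s : ℕ → ℝ) :
    ContDiff ℝ 1 fun x : ℝ => ∑' j, β j * ∫ ξ, osc (s j) x ξ * G ξ := by
  set M : ℝ → ℂ := fun ξ => ∑' j, β j * osc (s j) 0 ξ with hM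
  have hMc : Continuous M := by
    refine continuous_tsum (fun j => continuous_const.mul (osc_cont _ _)) hβ fun j ξ => ?_
    simp [osc_norm]
  have hMb : ∀ ξ, ‖M ξ‖ ≤ ∑' j, ‖β j‖ := fun ξ =>
    tsum_of_norm_bounded hβ.hasSum fun j => by simp [osc_norm]
  have hMG : Integrable fun ξ => M ξ * G ξ :=
    hG.bdd_mul hMc.aestronglyMeasurable (Filter.Eventually.of_forall hMb)
  have hMG1 : Integrable fun ξ : ℝ => M ξ * ((ξ : ℂ) * G ξ) :=
    hG1.bdd_mul hMc.aestronglyMeasurable (Filter.Eventually.of_forall hMb)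
  have hF : ContDiff ℝ 1 (𝓕 fun ξ => M ξ * G ξ) := by
    have := Real.contDiff_fourier (f := fun ξ : ℝ => M ξ * G ξ) (N := 1) (by
      intro n hn
      have hn' : n ≤ 1 := by exact_mod_cast hn
      interval_cases n
      · simpa using hMG.norm
      · refine hMG1.norm.congr (Filter.Eventually.of_forall fun ξ => ?_)
        simp; ring)
    exact_mod_cast this
  have heq : (fun x : ℝ => ∑' j, β j * ∫ ξ, osc (s j) x ξ * G ξ)
      = fun x : ℝ => 𝓕 (fun ξ => M ξ * G ξ) (-(2 * π)⁻¹ * x) := by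
    funext x
    have h := hasSum_integral_of_summable_integral_norm (μ := volume)
      (F := fun j ξ => β j * (osc (s j) x ξ * G ξ))
      (fun j => (osc_integrable hG _ _).const_mul _) (by
        simp only [norm_mul, osc_norm, one_mul, integral_const_mul]
        exact hβ.mul_right _)
    simp only [integral_const_mul] at h
    rw [h.tsum_eq, Real.fourier_real_eq_integral_exp_smul]
    refine integral_congr_ae (Filter.Eventually.of_forall fun ξ => ?_)
    have e1 : Complex.exp (((-2 * π * ξ * (-(2 * π)⁻¹ * x) : ℝ) : ℂ) * Complex.I) = osc 0 x ξ := by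
      unfold osc
      congr 1
      have : (-2 * π * ξ * (-(2 * π)⁻¹ * x) : ℝ) = x * ξ := by
        field_simp
      rw [this]; push_cast; ring
    simp only [smul_eq_mul]
    rw [e1, hM]
    simp only
    rw [← tsum_mul_right, ← tsum_mul_left]
    refine tsum_congr fun j => ?_
    rw [osc_split (s j) x]; ring
  rw [heq]
  exact hF.comp (by fun_prop)

lemma symK_deriv (ξ : ℝ) : HasDerivAt symK (-(symL ξ * symK ξ)) ξ := by
  have p1 : ξ ^ 2 + 4 ≠ 0 := by positivity
  have p2 : 1 + ξ ^ 4 ≠ 0 := by positivity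
  have h1 : HasDerivAt (fun ξ : ℝ => ξ ^ 2 + 4) (2 * ξ) ξ := by
    simpa using (hasDerivAt_pow 2 ξ).add_const 4
  have h2 : HasDerivAt (fun ξ : ℝ => 1 + ξ ^ 4) (4 * ξ ^ 3) ξ := by
    simpa using (hasDerivAt_pow 4 ξ).const_add 1
  have := (h1.inv p1).mul (h2.inv p2)
  refine this.congr_deriv ?_
  simp only [symL, symK, Pi.inv_apply]
  field_simp
  ring

lemma symG_cont : Continuous symG := by
  unfold symG
  exact Continuous.inv₀ (by fun_prop) fun x => by positivity

lemma symK_cont : Continuous symK := by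
  unfold symK
  exact (Continuous.inv₀ (by fun_prop) fun x => by positivity).mul
    (Continuous.inv₀ (by fun_prop) fun x => by positivity)

lemma symL_cont : Continuous symL := by
  unfold symL
  exact ((by fun_prop : Continuous fun x : ℝ => 2 * x).mul
    (Continuous.inv₀ (by fun_prop) fun x => by positivity)).add
    ((by fun_prop : Continuous fun x : ℝ => 4 * x ^ 3).mul
    (Continuous.inv₀ (by fun_prop) fun x => by positivity))

lemma symL_bound (ξ : ℝ) : |symL ξ| ≤ 5 := by
  unfold symL
  have a1 : |2 * ξ * (ξ ^ 2 + 4)⁻¹| ≤ 1 := by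
    rw [abs_mul, abs_inv, abs_of_pos (by positivity : 0 < ξ ^ 2 + 4), ← div_eq_mul_inv,
      div_le_one (by positivity), abs_le]
    constructor <;> nlinarith [sq_nonneg (ξ - 1), sq_nonneg (ξ + 1)]
  have a2 : |4 * ξ ^ 3 * (1 + ξ ^ 4)⁻¹| ≤ 4 := by
    rw [abs_mul, abs_inv, abs_of_pos (by positivity : 0 < 1 + ξ ^ 4), ← div_eq_mul_inv,
      div_le_iff₀ (by positivity), abs_le]
    constructor <;> nlinarith [sq_nonneg (ξ ^ 2 - ξ), sq_nonneg (ξ ^ 2 + ξ), sq_nonneg (ξ ^ 2 - 1),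
      sq_nonneg (ξ - 1), sq_nonneg (ξ + 1)]
  exact (abs_add_le _ _).trans (by linarith)

lemma symG_int : Integrable symG := by
  refine integrable_inv_one_add_sq.mono' symG_cont.aestronglyMeasurable
    (Filter.Eventually.of_forall fun ξ => ?_)
  unfold symG
  rw [Real.norm_of_nonneg (by positivity)]
  gcongr ?_⁻¹
  linarith

lemma symK_int : Integrable symK := by
  refine symG_int.mono' symK_cont.aestronglyMeasurable
    (Filter.Eventually.of_forall fun ξ => ?_)
  unfold symK symG
  rw [Real.norm_of_nonneg (by positivity)]
  refine mul_le_of_le_one_right (by positivity) (inv_le_one_of_one_le₀ ?_)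
  nlinarith [sq_nonneg (ξ ^ 2)]

lemma symK_int1 : Integrable fun ξ => ξ * symK ξ := by
  refine symG_int.mono' (continuous_id.mul symK_cont).aestronglyMeasurable
    (Filter.Eventually.of_forall fun ξ => ?_)
  unfold symK symG
  rw [Real.norm_eq_abs, mul_left_comm, abs_mul, abs_of_pos (by positivity : 0 < (ξ ^ 2 + 4)⁻¹)]
  refine mul_le_of_le_one_right (by positivity) ?_
  rw [abs_mul, abs_inv, abs_of_pos (by positivity : 0 < 1 + ξ ^ 4), ← div_eq_mul_inv,
      div_le_one (by positivity), abs_le]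
  constructor <;> nlinarith [sq_nonneg (ξ ^ 2 - 1), sq_nonneg (ξ - 1), sq_nonneg (ξ + 1),
    sq_nonneg (ξ ^ 2)]

/-- complex versions -/
noncomputable def cK (ξ : ℝ) : ℂ := (symK ξ : ℂ)

/-- derivative of the improved symbol -/
noncomputable def cD (ξ : ℝ) : ℂ := ((-(symL ξ * symK ξ) : ℝ) : ℂ)

lemma cK_int : Integrable cK := symK_int.ofReal

lemma cK_int1 : Integrable fun ξ : ℝ => (ξ : ℂ) * cK ξ := by
  have := symK_int1.ofReal (𝕜 := ℂ)
  simpa [cK] using this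

lemma symLb {f : ℝ → ℝ} (hf : Integrable f) : Integrable fun ξ => symL ξ * f ξ :=
  hf.bdd_mul (c := 5) symL_cont.aestronglyMeasurable
    (Filter.Eventually.of_forall fun ξ => symL_bound ξ)

lemma cD_int : Integrable cD := (symLb symK_int).neg.ofReal

lemma cD_int1 : Integrable fun ξ : ℝ => (ξ : ℂ) * cD ξ := by
  have := (symLb symK_int1).neg.ofReal (𝕜 := ℂ)
  refine this.congr (Filter.Eventually.of_forall fun ξ => ?_)
  simp [cD]; ring

lemma osc_deriv (s x ξ : ℝ) :
    HasDerivAt (osc s x) (osc s x ξ * (Complex.I * (x - 5 * s * ξ ^ 4))) ξ := by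
  have h1 : HasDerivAt (fun ξ : ℝ => (ξ : ℂ)) 1 ξ := Complex.ofRealCLM.hasDerivAt
  have h2 := (((h1.const_mul (x : ℂ)).sub ((h1.pow 5).const_mul (s : ℂ))).const_mul
    Complex.I).cexp
  refine h2.congr_deriv ?_
  simp [osc]
  ring_nf

lemma parts (s x : ℝ) (hs : s ≠ 0) :
    ∫ ξ, osc s x ξ * (symG ξ : ℂ) =
      (∫ ξ, osc s x ξ * cK ξ) + x * ((5 * s : ℂ)⁻¹ * ∫ ξ, osc s x ξ * cK ξ)
        + (5 * s * Complex.I)⁻¹ * ∫ ξ, osc s x ξ * cD ξ := by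
  have iG := osc_integrable (symG_int.ofReal (𝕜 := ℂ)) s x
  have iK := osc_integrable cK_int s x
  have iD := osc_integrable cD_int s x
  have hd : ∀ ξ, HasDerivAt (fun ξ => osc s x ξ * cK ξ)
      ((Complex.I * x + 5 * s * Complex.I) * (osc s x ξ * cK ξ)
        - (5 * s * Complex.I) * (osc s x ξ * (symG ξ : ℂ)) + osc s x ξ * cD ξ) ξ := by
    intro ξ
    have := (osc_deriv s x ξ).mul (symK_deriv ξ).ofReal_comp
    refine this.congr_deriv ?_
    have hk : ((ξ : ℂ) ^ 4) * (symK ξ : ℂ) = (symG ξ : ℂ) - (symK ξ : ℂ) := by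
      have : ξ ^ 4 * symK ξ = symG ξ - symK ξ := by
        unfold symK symG; field_simp; ring
      exact_mod_cast this
    simp only [cK, cD]
    linear_combination (-5 * s * Complex.I * osc s x ξ) * hk
  have h0 := integral_eq_zero_of_hasDerivAt_of_integrable hd
    (((iK.const_mul _).sub (iG.const_mul _)).add iD) iK
  have h1 := iK.const_mul (Complex.I * x + 5 * s * Complex.I)
  have h2 := iG.const_mul (5 * s * Complex.I)
  have h3 : Integrable fun ξ => (Complex.I * x + 5 * s * Complex.I) * (osc s x ξ * cK ξ)
        - (5 * s * Complex.I) * (osc s x ξ * (symG ξ : ℂ)) := h1.sub h2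
  have e3 := integral_add h3 iD
  have e4 := integral_sub h1 h2
  simp only [RCLike.ofReal_eq_complex_ofReal] at e3 e4
  rw [e3, e4, integral_const_mul, integral_const_mul] at h0
  have hs' : (s : ℂ) ≠ 0 := by exact_mod_cast hs
  have hI := Complex.I_ne_zero
  generalize (∫ ξ, osc s x ξ * (symG ξ : ℂ)) = A at *
  generalize (∫ ξ, osc s x ξ * cK ξ) = B at *
  generalize (∫ ξ, osc s x ξ * cD ξ) = C at *
  field_simp
  linear_combination -h0

lemma Wphi_eq : ∃ c : ℂ, ∀ s x : ℝ, Wphi s x = c * ∫ ξ, osc s x ξ * (symG ξ : ℂ) := by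
  refine ⟨(Real.sqrt (2 * π) : ℂ)⁻¹ * (4 * (Real.sqrt (2 * π) : ℂ)⁻¹), fun s x => ?_⟩
  unfold Wphi
  rw [mul_assoc _ _ (∫ ξ, osc s x ξ * (symG ξ : ℂ)),
    ← integral_const_mul (4 * (Real.sqrt (2 * π) : ℂ)⁻¹)]
  congr 1
  refine integral_congr_ae (Filter.Eventually.of_forall fun ξ => ?_)
  simp only [osc, phiHat, symG]
  push_cast
  rw [div_eq_mul_inv, mul_inv]
  ring

theorem stmt18 (α : ℕ → ℝ) (hpos : ∀ j : ℕ, 0 < α j)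
    (hsum : Summable fun j : ℕ => α j * Real.exp (4 * (j + 1))) :
    ∀ t : ℝ, 0 < t → (¬ ∃ n : ℕ, 0 < n ∧ t = (n : ℝ)) →
      (∀ x : ℝ, Summable fun j : ℕ => (α j : ℂ) * Wphi (t - ((j : ℝ) + 1)) x) ∧
        ContDiff ℝ 1 (fun x : ℝ => ∑' j : ℕ, (α j : ℂ) * Wphi (t - ((j : ℝ) + 1)) x) := by
  intro t ht hn
  set s : ℕ → ℝ := fun j => t - ((j : ℝ) + 1) with hs
  have hs0 : ∀ j, s j ≠ 0 := by
    intro j h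
    refine hn ⟨j + 1, by omega, ?_⟩
    push_cast
    simp only [hs] at h
    linarith
  have hα : Summable fun j => α j := by
    refine Summable.of_nonneg_of_le (fun j => (hpos j).le) (fun j => ?_) hsum
    exact le_mul_of_one_le_right (hpos j).le (Real.one_le_exp (by positivity))
  -- eventually `|s j| ≥ 1`, so the weighted coefficients are summable
  have hαs : Summable fun j => α j * |s j|⁻¹ := by
    refine Summable.of_norm_bounded_eventually_nat hα ?_
    filter_upwards [Filter.eventually_ge_atTop ⌈t⌉₊] with j hj
    have hj' : t ≤ j := (Nat.le_ceil t).trans (by exact_mod_cast hj)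
    have : 1 ≤ |s j| := by
      rw [le_abs]; right; simp only [hs]; linarith
    rw [Real.norm_of_nonneg (mul_nonneg (hpos j).le (by positivity))]
    exact mul_le_of_le_one_right (hpos j).le (inv_le_one_of_one_le₀ this)
  obtain ⟨c, hc⟩ := Wphi_eq
  have b1 : Summable fun j => ‖(α j : ℂ)‖ := by
    refine hα.congr fun j => ?_
    simp [abs_of_pos (hpos j)]
  have b2 : Summable fun j => ‖(α j : ℂ) * (5 * s j : ℂ)⁻¹‖ := by
    refine (hαs.mul_left 5⁻¹).congr fun j => ?_
    simp [abs_of_pos (hpos j)]; ring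
  have b3 : Summable fun j => ‖(α j : ℂ) * (5 * s j * Complex.I : ℂ)⁻¹‖ := by
    refine b2.congr fun j => ?_
    simp
  have key : ∀ x j, (α j : ℂ) * Wphi (s j) x =
      c * ((α j : ℂ) * (∫ ξ, osc (s j) x ξ * cK ξ)
        + x * ((α j : ℂ) * (5 * s j : ℂ)⁻¹ * ∫ ξ, osc (s j) x ξ * cK ξ)
        + (α j : ℂ) * (5 * s j * Complex.I : ℂ)⁻¹ * ∫ ξ, osc (s j) x ξ * cD ξ) := by
    intro x j
    rw [hc, parts _ _ (hs0 j)]; ring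
  have S1 := fun x => osc_summable (G := cK) b1 s x
  have S2 := fun x => osc_summable (G := cK) b2 s x
  have S3 := fun x => osc_summable (G := cD) b3 s x
  have S2' := fun x : ℝ => (S2 x).mul_left (x : ℂ)
  constructor
  · intro x
    exact ((((S1 x).add (S2' x)).add (S3 x)).mul_left c).congr fun j => (key x j).symm
  · have : (fun x : ℝ => ∑' j : ℕ, (α j : ℂ) * Wphi (s j) x) = fun x : ℝ =>
        c * ((∑' j, (α j : ℂ) * (∫ ξ, osc (s j) x ξ * cK ξ))
        + x * (∑' j, (α j : ℂ) * (5 * s j : ℂ)⁻¹ * ∫ ξ, osc (s j) x ξ * cK ξ)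
        + ∑' j, (α j : ℂ) * (5 * s j * Complex.I : ℂ)⁻¹ * ∫ ξ, osc (s j) x ξ * cD ξ) := by
      funext x
      rw [tsum_congr (key x), tsum_mul_left, ((S1 x).add (S2' x)).tsum_add (S3 x),
        (S1 x).tsum_add (S2' x), tsum_mul_left]
    rw [this]
    have d1 := osc_contDiff cK_int cK_int1 b1 s
    have d2 := osc_contDiff cK_int cK_int1 b2 s
    have d3 := osc_contDiff cD_int cD_int1 b3 s
    have d0 : ContDiff ℝ 1 (fun x : ℝ => (x : ℂ)) := Complex.ofRealCLM.contDiff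
    exact contDiff_const.mul ((d1.add (d0.mul d2)).add d3)
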